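/- Fix 𝔘 ∈ ℝ, let M_𝔘(v) = (2π)^{−3/2} exp(−((v_x−𝔘)² + v_y² + v_z²)/2), and for differentiable f : ℝ³ → ℝ define (N f)(v) = v_x² ∂f/∂v_y − v_x v_y ∂f/∂v_x − 𝔘 v_x v_y f(v). Set χ̄₀(v) = 1, χ̄₁(v) = v_x − 𝔘, χ̄₃(v) = v_z, χ̄₄(v) = ((v_x−𝔘)² + v_y² + v_z²)/2. Then for every α ∈ {0, 1, 3, 4} and every Schwartz function w : ℝ³ → ℝ, ∫_{ℝ³} M_𝔘 χ̄_α (N w) dv = ∫_{ℝ³} M_𝔘 v_y χ̄_α w dv + (δ_{α,1} − 𝔘 δ_{α,4}) ∫_{ℝ³} M_𝔘 v_x v_y w dv, where δ_{α,β} is the Kronecker delta. -/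

import Mathlib

open MeasureTheory Real

/-- The Maxwellian on `ℝ³` drifted by `𝔘` in the `x`-direction. -/
noncomputable def Mdrift (𝔘 : ℝ) (v : Fin 3 → ℝ) : ℝ :=
  (2 * π) ^ (-(3 : ℝ) / 2) * exp (-(((v 0 - 𝔘) ^ 2 + (v 1) ^ 2 + (v 2) ^ 2) / 2))

/-- The (conjugated) force operator from the cylindrical geometry:
`(N f)(v) = vₓ² ∂f/∂v_y − vₓ v_y ∂f/∂vₓ − 𝔘 vₓ v_y f(v)`. -/
noncomputable def Nforce (𝔘 : ℝ) (f : (Fin 3 → ℝ) → ℝ) (v : Fin 3 → ℝ) : ℝ :=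
  (v 0) ^ 2 * fderiv ℝ f v (Pi.single 1 1) - v 0 * v 1 * fderiv ℝ f v (Pi.single 0 1)
    - 𝔘 * v 0 * v 1 * f v

/-- The drifted collision invariants `χ̄₀ = 1`, `χ̄₁ = vₓ − 𝔘`, `χ̄₂ = v_y`,
`χ̄₃ = v_z`, `χ̄₄ = |v − (𝔘,0,0)|²/2`. -/
noncomputable def chiBar (𝔘 : ℝ) (j : Fin 5) (v : Fin 3 → ℝ) : ℝ :=
  if j = 0 then 1
  else if j = 1 then v 0 - 𝔘
  else if j = 2 then v 1
  else if j = 3 then v 2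
  else ((v 0 - 𝔘) ^ 2 + (v 1) ^ 2 + (v 2) ^ 2) / 2

/-- The coordinate functions have temperate growth. -/
@[fun_prop]
theorem hasTemperateGrowth_coord {ι : Type*} [Fintype ι] (i : ι) :
    Function.HasTemperateGrowth (fun v : ι → ℝ => v i) :=
  (ContinuousLinearMap.proj (R := ℝ) (φ := fun _ : ι => ℝ) i).hasTemperateGrowth

theorem continuous_Mdrift (𝔘 : ℝ) : Continuous (Mdrift 𝔘) := by
  unfold Mdrift
  fun_prop

theorem norm_Mdrift_le (𝔘 : ℝ) (v : Fin 3 → ℝ) : ‖Mdrift 𝔘 v‖ ≤ (2 * π) ^ (-(3 : ℝ) / 2) := by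
  have hc : 0 ≤ (2 * π) ^ (-(3 : ℝ) / 2) := by positivity
  rw [Mdrift, norm_mul, norm_of_nonneg hc, norm_of_nonneg (exp_pos _).le]
  refine mul_le_of_le_one_right hc (exp_le_one_iff.2 ?_)
  rw [neg_nonpos]
  positivity

/-- A Schwartz function times a function of temperate growth is integrable against the drifted
Maxwellian. -/
theorem integrable_Mdrift_mul (𝔘 : ℝ) {h : (Fin 3 → ℝ) → ℝ} (hh : h.HasTemperateGrowth)
    (w : SchwartzMap (Fin 3 → ℝ) ℝ) : Integrable (fun v => Mdrift 𝔘 v * h v * w v) := by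
  have hi := (SchwartzMap.smulLeftCLM ℝ h w).integrable (μ := volume)
  rw [SchwartzMap.smulLeftCLM_apply hh] at hi
  simpa only [smul_eq_mul, mul_assoc] using hi.bdd_mul
    (continuous_Mdrift 𝔘).aestronglyMeasurable (Filter.Eventually.of_forall (norm_Mdrift_le 𝔘))

theorem integrable_Mdrift_mul_fderiv (𝔘 : ℝ) {h : (Fin 3 → ℝ) → ℝ} (hh : h.HasTemperateGrowth)
    (w : SchwartzMap (Fin 3 → ℝ) ℝ) (m : Fin 3 → ℝ) :
    Integrable (fun v => Mdrift 𝔘 v * h v * fderiv ℝ w v m) := by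
  simpa only [SchwartzMap.lineDerivOp_apply_eq_fderiv] using
    integrable_Mdrift_mul 𝔘 hh (LineDeriv.lineDerivOp m w)

theorem hasLineDerivAt_Mdrift (𝔘 : ℝ) (i : Fin 3) (v : Fin 3 → ℝ) :
    HasLineDerivAt ℝ (Mdrift 𝔘) (-(Mdrift 𝔘 v * (v i - if i = 0 then 𝔘 else 0))) v
      (Pi.single i 1) := by
  have key (j : Fin 3) (c : ℝ) :
      HasDerivAt (fun t : ℝ => ((v + t • (Pi.single i 1 : Fin 3 → ℝ)) j - c) ^ 2)
        (2 * (v j - c) * if j = i then 1 else 0) 0 := by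
    have := ((((hasDerivAt_id (0 : ℝ)).mul_const ((Pi.single i (1 : ℝ) : Fin 3 → ℝ) j)).const_add
      (v j)).sub_const c).pow 2
    simpa [Pi.single_apply] using! this
  have h := (((((key 0 𝔘).add (key 1 0)).add (key 2 0)).div_const 2).neg.exp).const_mul
    ((2 * π) ^ (-(3 : ℝ) / 2))
  unfold HasLineDerivAt Mdrift
  simp only [sub_zero] at h
  refine h.congr_deriv ?_
  fin_cases i <;> simp <;> ring

/-- Integration by parts against the drifted Maxwellian. -/
theorem integral_Mdrift_mul_fderiv (𝔘 : ℝ) (i : Fin 3) {h h' : (Fin 3 → ℝ) → ℝ}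
    (hh : h.HasTemperateGrowth) (hh' : h'.HasTemperateGrowth)
    (hd : ∀ v, HasLineDerivAt ℝ h (h' v) v (Pi.single i 1)) (w : SchwartzMap (Fin 3 → ℝ) ℝ) :
    ∫ v, Mdrift 𝔘 v * h v * fderiv ℝ w v (Pi.single i 1) =
      ∫ v, Mdrift 𝔘 v * ((v i - if i = 0 then 𝔘 else 0) * h v - h' v) * w v := by
  have hg : Function.HasTemperateGrowth
      (fun v : Fin 3 → ℝ => -((v i - if i = 0 then 𝔘 else 0) * h v - h' v)) := by fun_prop
  have := integral_bilinear_hasLineDerivAt_right_eq_neg_left_of_integrable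
    (μ := (volume : Measure (Fin 3 → ℝ))) (B := ContinuousLinearMap.mul ℝ ℝ) (v := Pi.single i 1)
    (f := fun v => Mdrift 𝔘 v * h v) (g := w) (g' := fun v => fderiv ℝ w v (Pi.single i 1))
    (f' := fun v => Mdrift 𝔘 v * -((v i - if i = 0 then 𝔘 else 0) * h v - h' v))
    (integrable_Mdrift_mul 𝔘 hg w) (integrable_Mdrift_mul_fderiv 𝔘 hh w _)
    (integrable_Mdrift_mul 𝔘 hh w)
    (fun v _ => by
      refine ((hasLineDerivAt_Mdrift 𝔘 i v).fun_mul (hd v)).congr_deriv ?_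
      simp
      ring)
    (fun v _ => w.differentiableAt.hasFDerivAt.hasLineDerivAt _)
  simp only [ContinuousLinearMap.mul_apply'] at this
  rw [this, ← integral_neg]
  congr 1 with v
  ring

/-- Moments of `Nforce` against a general weight `χ` with partial derivatives `χx`, `χy`. -/
theorem integral_Mdrift_mul_Nforce (𝔘 : ℝ) {χ χx χy : (Fin 3 → ℝ) → ℝ}
    (hχ : χ.HasTemperateGrowth) (hχx : χx.HasTemperateGrowth) (hχy : χy.HasTemperateGrowth)
    (hx : ∀ v, HasLineDerivAt ℝ χ (χx v) v (Pi.single 0 1))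
    (hy : ∀ v, HasLineDerivAt ℝ χ (χy v) v (Pi.single 1 1)) (w : SchwartzMap (Fin 3 → ℝ) ℝ) :
    ∫ v, Mdrift 𝔘 v * χ v * Nforce 𝔘 w v =
      (∫ v, Mdrift 𝔘 v * v 1 * χ v * w v) +
        ∫ v, Mdrift 𝔘 v * (v 0 * v 1 * χx v - v 0 ^ 2 * χy v) * w v := by
  have hA : Function.HasTemperateGrowth (fun v : Fin 3 → ℝ => v 0 ^ 2 * χ v) := by fun_prop
  have hB : Function.HasTemperateGrowth (fun v : Fin 3 → ℝ => v 0 * v 1 * χ v) := by fun_prop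
  have hC : Function.HasTemperateGrowth (fun v : Fin 3 → ℝ => 𝔘 * v 0 * v 1 * χ v) := by fun_prop
  have hA' : Function.HasTemperateGrowth (fun v : Fin 3 → ℝ => v 0 ^ 2 * χy v) := by fun_prop
  have hB' : Function.HasTemperateGrowth
      (fun v : Fin 3 → ℝ => v 1 * χ v + v 0 * v 1 * χx v) := by fun_prop
  have hdA (v : Fin 3 → ℝ) : HasLineDerivAt ℝ (fun v : Fin 3 → ℝ => v 0 ^ 2 * χ v)
      (v 0 ^ 2 * χy v) v (Pi.single 1 1) := by
    have := HasDerivAt.const_mul (v 0 ^ 2) (hy v)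
    simpa [HasLineDerivAt] using this
  have hdB (v : Fin 3 → ℝ) : HasLineDerivAt ℝ (fun v : Fin 3 → ℝ => v 0 * v 1 * χ v)
      (v 1 * χ v + v 0 * v 1 * χx v) v (Pi.single 0 1) := by
    have := (((hasDerivAt_id (0 : ℝ)).const_add (v 0)).mul_const (v 1)).fun_mul (hx v)
    simpa [HasLineDerivAt] using this
  have eA := integral_Mdrift_mul_fderiv 𝔘 1 hA hA' hdA w
  have eB := integral_Mdrift_mul_fderiv 𝔘 0 hB hB' hdB w
  have iA := integrable_Mdrift_mul_fderiv 𝔘 hA w (Pi.single 1 1)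
  have iB := integrable_Mdrift_mul_fderiv 𝔘 hB w (Pi.single 0 1)
  have iC := integrable_Mdrift_mul 𝔘 hC w
  have iA' := integrable_Mdrift_mul 𝔘 (h := fun v => (v 1 - if (1 : Fin 3) = 0 then 𝔘 else 0) *
    (v 0 ^ 2 * χ v) - v 0 ^ 2 * χy v) (by fun_prop) w
  have iB' := integrable_Mdrift_mul 𝔘 (h := fun v => (v 0 - if (0 : Fin 3) = 0 then 𝔘 else 0) *
    (v 0 * v 1 * χ v) - (v 1 * χ v + v 0 * v 1 * χx v)) (by fun_prop) w
  have iD := integrable_Mdrift_mul 𝔘 (h := fun v => v 1 * χ v) (by fun_prop) w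
  have iE := integrable_Mdrift_mul 𝔘 (h := fun v => v 0 * v 1 * χx v - v 0 ^ 2 * χy v)
    (by fun_prop) w
  calc ∫ v, Mdrift 𝔘 v * χ v * Nforce 𝔘 w v
      = ∫ v, (Mdrift 𝔘 v * (v 0 ^ 2 * χ v) * fderiv ℝ w v (Pi.single 1 1)
          - Mdrift 𝔘 v * (v 0 * v 1 * χ v) * fderiv ℝ w v (Pi.single 0 1)
          - Mdrift 𝔘 v * (𝔘 * v 0 * v 1 * χ v) * w v) := by
        congr 1 with v
        rw [Nforce]
        ring
    _ = _ := by
        rw [integral_sub (iA.sub' iB) iC, integral_sub iA iB, eA, eB, ← integral_sub iA' iB',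
          ← integral_sub (iA'.sub' iB') iC]
        simp only [mul_assoc] at iD iE ⊢
        rw [← integral_add iD iE]
        congr 1 with v
        simp
        ring

/-- The moment identity from Section 3 of the paper:
`(χ̄_α, N w) = ∫ dv [v_y M χ̄_α w + M vₓ v_y w (δ_{α,1} − 𝔘 δ_{α,4})]`
for `α ∈ {0, 1, 3, 4}`. -/
theorem force_moment_identity (𝔘 : ℝ) :
    ∀ α ∈ ({0, 1, 3, 4} : Set (Fin 5)), ∀ w : SchwartzMap (Fin 3 → ℝ) ℝ,
      ∫ v : Fin 3 → ℝ, Mdrift 𝔘 v * chiBar 𝔘 α v * Nforce 𝔘 (⇑w) v =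
        (∫ v : Fin 3 → ℝ, Mdrift 𝔘 v * v 1 * chiBar 𝔘 α v * w v) +
          ((if α = 1 then (1 : ℝ) else 0) - 𝔘 * (if α = 4 then (1 : ℝ) else 0)) *
            ∫ v : Fin 3 → ℝ, Mdrift 𝔘 v * v 0 * v 1 * w v := by
  have line (v : Fin 3 → ℝ) (i : Fin 3) (c : ℝ) : HasDerivAt (fun t : ℝ => v i + t - c) 1 0 :=
    ((hasDerivAt_id (0 : ℝ)).const_add (v i)).sub_const c
  rintro α (rfl | rfl | rfl | rfl) w
  · rw [integral_Mdrift_mul_Nforce 𝔘 (χ := chiBar 𝔘 0) (χx := fun _ => 0) (χy := fun _ => 0)]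
    · simp
    · unfold chiBar; simp
    · fun_prop
    · fun_prop
    · intro v; simpa [HasLineDerivAt, chiBar] using hasDerivAt_const (0 : ℝ) (1 : ℝ)
    · intro v; simpa [HasLineDerivAt, chiBar] using hasDerivAt_const (0 : ℝ) (1 : ℝ)
  · rw [integral_Mdrift_mul_Nforce 𝔘 (χ := chiBar 𝔘 1) (χx := fun _ => 1) (χy := fun _ => 0)]
    · simp [mul_assoc]
    · unfold chiBar; simp; fun_prop
    · fun_prop
    · fun_prop
    · intro v; simpa [HasLineDerivAt, chiBar] using line v 0 𝔘
    · intro v; simpa [HasLineDerivAt, chiBar] using hasDerivAt_const (0 : ℝ) (v 0 - 𝔘)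
  · rw [integral_Mdrift_mul_Nforce 𝔘 (χ := chiBar 𝔘 3) (χx := fun _ => 0) (χy := fun _ => 0)]
    · simp
    · unfold chiBar; simp; fun_prop
    · fun_prop
    · fun_prop
    · intro v; simpa [HasLineDerivAt, chiBar] using hasDerivAt_const (0 : ℝ) (v 2)
    · intro v; simpa [HasLineDerivAt, chiBar] using hasDerivAt_const (0 : ℝ) (v 2)
  · rw [integral_Mdrift_mul_Nforce 𝔘 (χ := chiBar 𝔘 4) (χx := fun v => v 0 - 𝔘)
      (χy := fun v => v 1)]
    · rw [← integral_const_mul]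
      congr 2 with v
      simp
      ring
    · unfold chiBar; simp [div_eq_mul_inv]; fun_prop
    · fun_prop
    · fun_prop
    · intro v
      have := ((((line v 0 𝔘).fun_pow 2).add_const (v 1 ^ 2)).add_const (v 2 ^ 2)).div_const 2
      simpa [HasLineDerivAt, chiBar] using this
    · intro v
      have := ((((line v 1 0).fun_pow 2).const_add ((v 0 - 𝔘) ^ 2)).add_const (v 2 ^ 2)).div_const 2
      simpa [HasLineDerivAt, chiBar] using this
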